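/- Let μ > 0, λ ≥ 0, δ ∈ (0, 1), and let g_λ : ℝ^d → ℝ be g_λ(x) = Σᵢ (μ − max(√μ − |xᵢ|, 0)²) + λ‖x‖₁ + ‖x‖². Suppose x', z' ∈ ℝ^d satisfy 2z' ∈ ∂g_λ(x') and |z'ᵢ| ∉ [(1−δ)√μ + λ/2, √μ/(1−δ) + λ/2] for every i. Then for every v ∈ ℝ^d with v ≠ 0 and every z'' with 2z'' ∈ ∂g_λ(x' + v), one has ⟨z'' − z', v⟩ > δ‖v‖². -/

import Mathlib

noncomputable section

open scoped BigOperators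

/-- ℓ¹ norm -/
def l1 {d : ℕ} (x : Fin d → ℝ) : ℝ := ∑ i, |x i|

/-- squared Euclidean norm -/
def sqnorm {d : ℕ} (x : Fin d → ℝ) : ℝ := ∑ i, (x i) ^ 2

/-- Euclidean inner product -/
def ip {d : ℕ} (x y : Fin d → ℝ) : ℝ := ∑ i, x i * y i

/-- `g_λ(x) = Σᵢ (μ − max(√μ − |xᵢ|, 0)²) + λ‖x‖₁ + ‖x‖²` -/
def gfun {d : ℕ} (μ lam : ℝ) (x : Fin d → ℝ) : ℝ :=
  (∑ i, (μ - max (Real.sqrt μ - |x i|) 0 ^ 2)) + lam * l1 x + sqnorm x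

/-- subdifferential of a convex function on ℝ^d -/
def subdiff {d : ℕ} (g : (Fin d → ℝ) → ℝ) (x : Fin d → ℝ) : Set (Fin d → ℝ) :=
  {s | ∀ y, g x + ip s (y - x) ≤ g y}

/-- One coordinate of `gfun`, written in terms of `s = √μ`. -/
def gcoord (s lam t : ℝ) : ℝ := s ^ 2 - max (s - |t|) 0 ^ 2 + lam * |t| + t ^ 2

/-- `z` is half a subgradient of `gcoord s lam` at `t`. -/
def IsHalfSubgrad (s lam t z : ℝ) : Prop :=
  ∀ y, gcoord s lam t + 2 * z * (y - t) ≤ gcoord s lam y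

lemma gfun_eq_sum {d : ℕ} {μ : ℝ} (hμ : 0 ≤ μ) (lam : ℝ) (x : Fin d → ℝ) :
    gfun μ lam x = ∑ i, gcoord (Real.sqrt μ) lam (x i) := by
  simp only [gfun, gcoord, l1, sqnorm, Real.sq_sqrt hμ, Finset.sum_add_distrib, Finset.mul_sum]

lemma isHalfSubgrad_of_mem_subdiff {d : ℕ} {μ lam : ℝ} (hμ : 0 ≤ μ) {x z : Fin d → ℝ}
    (h : (2 : ℝ) • z ∈ subdiff (gfun μ lam) x) (i : Fin d) :
    IsHalfSubgrad (Real.sqrt μ) lam (x i) (z i) := by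
  intro y
  have h1 := h (Function.update x i y)
  rw [gfun_eq_sum hμ, gfun_eq_sum hμ, ip, ← Finset.sum_add_distrib, ← sub_nonneg,
    ← Finset.sum_sub_distrib, Finset.sum_eq_single i] at h1
  · simpa using h1
  · intro j _ hj
    simp [Function.update_of_ne hj]
  · simp

lemma gcoord_neg (s lam t : ℝ) : gcoord s lam (-t) = gcoord s lam t := by
  simp [gcoord]

lemma IsHalfSubgrad.neg {s lam t z : ℝ} (h : IsHalfSubgrad s lam t z) :
    IsHalfSubgrad s lam (-t) (-z) := by
  intro y
  have := h (-y)
  rw [gcoord_neg] at this ⊢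
  linarith

lemma gcoord_le_quadratic {s lam t y : ℝ} (ht : 0 ≤ t) (hy : 0 ≤ y) :
    gcoord s lam y ≤ gcoord s lam t + 2 * (max s t + lam / 2) * (y - t) + (y - t) ^ 2 := by
  unfold gcoord
  rw [abs_of_nonneg ht, abs_of_nonneg hy]
  rcases max_cases (s - y) 0 with ⟨h1, h1'⟩ | ⟨h1, h1'⟩ <;>
  rcases max_cases (s - t) 0 with ⟨h2, h2'⟩ | ⟨h2, h2'⟩ <;>
  rcases max_cases s t with ⟨h3, h3'⟩ | ⟨h3, h3'⟩ <;> rw [h1, h2, h3] <;> nlinarith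

lemma IsHalfSubgrad.eq_of_pos {s lam t z : ℝ} (h : IsHalfSubgrad s lam t z) (ht : 0 < t) :
    z = max s t + lam / 2 := by
  have key : ∀ ε, -t ≤ ε → 2 * (z - (max s t + lam / 2)) * ε ≤ ε ^ 2 := by
    intro ε hε
    have h1 := h (t + ε)
    have h2 := gcoord_le_quadratic (s := s) (lam := lam) ht.le (show 0 ≤ t + ε by linarith)
    rw [add_sub_cancel_left] at h1 h2
    linarith
  generalize max s t + lam / 2 = m at key
  rcases lt_trichotomy z m with hlt | heq | hgt
  · have hpos : 0 < min (m - z) t := lt_min (by linarith) ht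
    have h1 := key (-min (m - z) t) (by linarith [min_le_right (m - z) t])
    nlinarith [min_le_left (m - z) t]
  · exact heq
  · have h1 := key (z - m) (by linarith)
    nlinarith

lemma IsHalfSubgrad.le_of_zero {s lam z : ℝ} (hs : 0 < s) (h : IsHalfSubgrad s lam 0 z) :
    z ≤ s + lam / 2 := by
  have h1 := h s
  simp only [gcoord, abs_zero, abs_of_pos hs, sub_zero, sub_self, max_self, max_eq_left hs.le] at h1
  nlinarith

lemma IsHalfSubgrad.le_of_nonneg {s lam t z : ℝ} (hs : 0 < s) (h : IsHalfSubgrad s lam t z)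
    (ht : 0 ≤ t) : z ≤ max s t + lam / 2 := by
  rcases ht.eq_or_lt with rfl | ht
  · rw [max_eq_left hs.le]
    exact h.le_of_zero hs
  · exact (h.eq_of_pos ht).le

lemma IsHalfSubgrad.eq_of_neg {s lam t z : ℝ} (h : IsHalfSubgrad s lam t z) (ht : t < 0) :
    z = -(max s (-t) + lam / 2) := by
  linarith [h.neg.eq_of_pos (neg_pos.2 ht)]

lemma growth_of_small {s lam δ z v w : ℝ} (hδ : δ ∈ Set.Ioo (0 : ℝ) 1)
    (hz : |z| < (1 - δ) * s + lam / 2) (hv : v ≠ 0) (hw : IsHalfSubgrad s lam v w) :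
    δ * v ^ 2 < (w - z) * v := by
  obtain ⟨hδ0, hδ1⟩ := hδ
  wlog hpos : 0 < v generalizing v w z
  · have := this (z := -z) (by rwa [abs_neg]) (neg_ne_zero.2 hv) hw.neg
      (by rcases hv.lt_or_gt with h | h <;> [linarith; exact absurd h hpos])
    linarith
  have h1 := hw.eq_of_pos hpos
  have h2 : δ * v < w - z := by
    nlinarith [le_max_left s v, le_max_right s v, le_abs_self z]
  nlinarith

lemma growth_of_large {s lam δ t z v w : ℝ} (hs : 0 < s) (hlam : 0 ≤ lam)
    (hδ : δ ∈ Set.Ioo (0 : ℝ) 1) (hz : IsHalfSubgrad s lam t z)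
    (ht : 0 < t) (hbig : s / (1 - δ) + lam / 2 < z) (hv : v ≠ 0)
    (hw : IsHalfSubgrad s lam (t + v) w) :
    δ * v ^ 2 < (w - z) * v := by
  obtain ⟨hδ0, hδ1⟩ := hδ
  have hv2 : 0 < v ^ 2 := by positivity
  have hz1 := hz.eq_of_pos ht
  have hsδ : s ≤ s / (1 - δ) := by
    rw [le_div_iff₀ (by linarith)]
    nlinarith
  have hst : s < t := by
    by_contra! hcon
    rw [max_eq_left hcon] at hz1
    linarith
  rw [max_eq_right hst.le] at hz1
  have hst' : s < t * (1 - δ) := by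
    rw [← div_lt_iff₀ (by linarith)]
    linarith
  rcases lt_or_ge (t + v) 0 with hu | hu
  · have hw1 := hw.eq_of_neg hu
    have h1 : w - z ≤ v := by linarith [le_max_right s (-(t + v))]
    nlinarith
  · rcases le_or_gt (t + v) s with hus | hus
    · have hw1 := hw.le_of_nonneg hs hu
      rw [max_eq_left hus] at hw1
      have h1 : w - z < δ * v := by nlinarith
      nlinarith
    · have hw1 := hw.eq_of_pos (by linarith)
      rw [max_eq_right hus.le] at hw1
      have h1 : w - z = v := by linarith
      rw [h1]
      nlinarith

lemma IsHalfSubgrad.growth {s lam δ t z v w : ℝ} (hs : 0 < s) (hlam : 0 ≤ lam)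
    (hδ : δ ∈ Set.Ioo (0 : ℝ) 1) (hz : IsHalfSubgrad s lam t z)
    (hout : |z| ∉ Set.Icc ((1 - δ) * s + lam / 2) (s / (1 - δ) + lam / 2)) (hv : v ≠ 0)
    (hw : IsHalfSubgrad s lam (t + v) w) :
    δ * v ^ 2 < (w - z) * v := by
  wlog ht : 0 ≤ t generalizing t z v w
  · have := this hz.neg (by rwa [abs_neg]) (neg_ne_zero.2 hv)
      (by simpa only [neg_add] using hw.neg) (by linarith)
    linarith
  have hsδ : s ≤ s / (1 - δ) := by
    rw [le_div_iff₀ (by linarith [hδ.2])]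
    nlinarith [hδ.1]
  have hδs : (1 - δ) * s < s := by nlinarith [hδ.1]
  rcases ht.eq_or_lt with rfl | ht
  · have h1 : |z| ≤ s + lam / 2 :=
      abs_le'.2 ⟨hz.le_of_zero hs, IsHalfSubgrad.le_of_zero hs (by simpa using hz.neg)⟩
    rw [zero_add] at hw
    exact growth_of_small hδ (by by_contra! hcon; exact hout ⟨hcon, by linarith⟩) hv hw
  · have h1 := hz.eq_of_pos ht
    have h2 : s + lam / 2 ≤ z := by linarith [le_max_left s t]
    rw [abs_of_nonneg (by linarith)] at hout
    exact growth_of_large hs hlam hδ hz ht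
      (by by_contra! hcon; exact hout ⟨by linarith, hcon⟩) hv hw

/-- Lemma 2 of the paper (subgradient growth estimate). -/
theorem stmt9 {d : ℕ} (μ lam δ : ℝ) (hμ : 0 < μ) (hlam : 0 ≤ lam)
    (hδ : δ ∈ Set.Ioo (0:ℝ) 1)
    (x' z' : Fin d → ℝ) (hz' : (2:ℝ) • z' ∈ subdiff (gfun μ lam) x')
    (hout : ∀ i, |z' i| ∉
      Set.Icc ((1 - δ) * Real.sqrt μ + lam / 2) (Real.sqrt μ / (1 - δ) + lam / 2)) :
    ∀ v : Fin d → ℝ, v ≠ 0 → ∀ z'' : Fin d → ℝ,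
      (2:ℝ) • z'' ∈ subdiff (gfun μ lam) (x' + v) →
      ip (z'' - z') v > δ * sqnorm v := by
  intro v hv z'' hz''
  have hcoord : ∀ i, v i ≠ 0 → δ * v i ^ 2 < (z'' - z') i * v i := fun i hi =>
    (isHalfSubgrad_of_mem_subdiff hμ.le hz' i).growth (Real.sqrt_pos.2 hμ) hlam hδ (hout i) hi
      (isHalfSubgrad_of_mem_subdiff hμ.le hz'' i)
  obtain ⟨j, hj⟩ := Function.ne_iff.1 hv
  rw [gt_iff_lt, sqnorm, ip, Finset.mul_sum]
  refine Finset.sum_lt_sum (fun i _ => ?_) ⟨j, Finset.mem_univ j, hcoord j hj⟩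
  by_cases hi : v i = 0
  · simp [hi]
  · exact (hcoord i hi).le
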